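/- Let n ≥ 1 and let θ₀, …, θ_{n−1} be superfields with θ_j of parity (−1)^j (θ_j even for j even, odd for j odd). Define recursively θ_j[0] = θ_j and, for m = 0, …, n−1, assuming the even superfield θ_m[m] is invertible, δ_m = −(Dθ_m[m])(θ_m[m])⁻¹ and θ_j[m+1] = Dθ_j[m] + δ_m θ_j[m] for j > m. Then: (a) the composition T_n := (D+δ_{n−1})∘⋯∘(D+δ₀), where (D+δ)ψ := Dψ + δψ, annihilates every seed: T_n θ_j = 0 for j = 0, …, n−1; and (b) there exist superfields a₀, …, a_{n−1}, with a_i of parity (−1)^{n−i}, such that T_n ψ = D^n ψ + Σ_{i=0}^{n−1} a_i D^i ψ for every superfield ψ; in particular D^n θ_j + Σ_{i=0}^{n−1} a_i D^i θ_j = 0 for all j = 0, …, n−1. -/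

import Mathlib

noncomputable section
open scoped BigOperators

/-- The exterior algebra `Λ` of `ℝ^N`. -/
abbrev SuperAlg (N : ℕ) : Type := ExteriorAlgebra ℝ (Fin N → ℝ)

/-- The even part `Λ₀` of the exterior algebra. -/
def LambdaEven (N : ℕ) : Submodule ℝ (SuperAlg N) :=
  CliffordAlgebra.evenOdd (0 : QuadraticForm ℝ (Fin N → ℝ)) 0

/-- The odd part `Λ₁` of the exterior algebra. -/
def LambdaOdd (N : ℕ) : Submodule ℝ (SuperAlg N) :=
  CliffordAlgebra.evenOdd (0 : QuadraticForm ℝ (Fin N → ℝ)) 1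

/-- A superfield: a pair `(f₀, f₁)` of maps `ℝ² → Λ`, encoding
`f(x,t,ϑ) = f₀(x,t) + ϑ f₁(x,t)`. -/
@[ext] structure SF (N : ℕ) where
  c0 : ℝ → ℝ → SuperAlg N
  c1 : ℝ → ℝ → SuperAlg N

namespace SF
variable {N : ℕ}

instance : Zero (SF N) := ⟨⟨0, 0⟩⟩
instance : Add (SF N) := ⟨fun f g => ⟨f.c0 + g.c0, f.c1 + g.c1⟩⟩
instance : Neg (SF N) := ⟨fun f => ⟨-f.c0, -f.c1⟩⟩
instance : Sub (SF N) := ⟨fun f g => ⟨f.c0 - g.c0, f.c1 - g.c1⟩⟩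
instance : SMul ℕ (SF N) := ⟨fun n f => ⟨n • f.c0, n • f.c1⟩⟩
instance : SMul ℤ (SF N) := ⟨fun n f => ⟨n • f.c0, n • f.c1⟩⟩
instance : SMul ℝ (SF N) := ⟨fun r f => ⟨r • f.c0, r • f.c1⟩⟩

instance : AddCommGroup (SF N) :=
  Function.Injective.addCommGroup
    (M₂ := (ℝ → ℝ → SuperAlg N) × (ℝ → ℝ → SuperAlg N))
    (fun f => (f.c0, f.c1))
    (fun a b h => by cases a; cases b; simpa using h)
    rfl (fun _ _ => rfl) (fun _ => rfl) (fun _ _ => rfl) (fun _ _ => rfl) (fun _ _ => rfl)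

instance : One (SF N) := ⟨⟨fun _ _ => 1, fun _ _ => 0⟩⟩

/-- The product of superfields: `(fg)₀ = f₀g₀`,
`(fg)₁ = f₁g₀ + σ(f₀)g₁` where `σ` is the grade involution of `Λ`
(this is the bilinear extension of the parity-sign formula for homogeneous factors). -/
instance : Mul (SF N) := ⟨fun f g =>
  ⟨fun x t => f.c0 x t * g.c0 x t,
   fun x t => f.c1 x t * g.c0 x t + CliffordAlgebra.involute (f.c0 x t) * g.c1 x t⟩⟩

/-- An even superfield. -/
def IsEven (f : SF N) : Prop :=
  (∀ x t, f.c0 x t ∈ LambdaEven N) ∧ (∀ x t, f.c1 x t ∈ LambdaOdd N)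

/-- An odd superfield. -/
def IsOdd (f : SF N) : Prop :=
  (∀ x t, f.c0 x t ∈ LambdaOdd N) ∧ (∀ x t, f.c1 x t ∈ LambdaEven N)

/-- A superfield is invertible when `f₀(x,t)` is invertible in `Λ` for all `(x,t)`. -/
def Invertible (f : SF N) : Prop := ∀ x t, IsUnit (f.c0 x t)

/-- The multiplicative inverse of a superfield (junk unless `f` is invertible). -/
def sinv (f : SF N) : SF N :=
  ⟨fun x t => Ring.inverse (f.c0 x t),
   fun x t => -(Ring.inverse (CliffordAlgebra.involute (f.c0 x t)) * f.c1 x t *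
      Ring.inverse (f.c0 x t))⟩

end SF

/-- Derivative of a `Λ`-valued function of one real variable, characterized through all
linear functionals (junk value `0` when not differentiable). -/
def derLam {N : ℕ} (g : ℝ → SuperAlg N) (x : ℝ) : SuperAlg N := by
  classical
  exact if h : ∃ d : SuperAlg N, ∀ l : SuperAlg N →ₗ[ℝ] ℝ,
      HasDerivAt (fun y => l (g y)) (l d) x
    then h.choose else 0

/-- Smoothness of a `Λ`-valued function on `ℝ²`. -/
def SmoothLam {N : ℕ} (g : ℝ → ℝ → SuperAlg N) : Prop :=
  ∀ l : SuperAlg N →ₗ[ℝ] ℝ, ContDiff ℝ (⊤ : ℕ∞) (fun p : ℝ × ℝ => l (g p.1 p.2))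

namespace SF
variable {N : ℕ}

/-- A superfield is smooth when both components are. -/
def Smooth (f : SF N) : Prop := SmoothLam f.c0 ∧ SmoothLam f.c1

/-- `∂f`, the `x`-derivative. -/
def dx (f : SF N) : SF N :=
  ⟨fun x t => derLam (fun y => f.c0 y t) x, fun x t => derLam (fun y => f.c1 y t) x⟩

/-- `∂ₜf`, the `t`-derivative. -/
def dt (f : SF N) : SF N :=
  ⟨fun x t => derLam (fun s => f.c0 x s) t, fun x t => derLam (fun s => f.c1 x s) t⟩

/-- The odd superderivative `D`, with `Df = (f₁, ∂ₓf₀)`, so `D ∘ D = ∂`. -/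
def Dsd (f : SF N) : SF N := ⟨f.c1, fun x t => derLam (fun y => f.c0 y t) x⟩

end SF

/-- `D^n`. -/
def Dpow {N : ℕ} : ℕ → SF N → SF N
  | 0, f => f
  | m + 1, f => (Dpow m f).Dsd

/-- `∂^n`. -/
def Xpow {N : ℕ} : ℕ → SF N → SF N
  | 0, f => f
  | m + 1, f => (Xpow m f).dx

/-- `f` has the parity `(−1)^m`. -/
def parityAt {N : ℕ} (f : SF N) (m : ℕ) : Prop :=
  if m % 2 = 0 then f.IsEven else f.IsOdd

/-- The Manin–Radul supersymmetric KdV system. -/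
def MRSKdV {N : ℕ} (α u : SF N) : Prop :=
  α.dt = (1/4 : ℝ) • (α.dx.dx + (3:ℝ) • (α * α.Dsd) + (6:ℝ) • (α * u)).dx ∧
  u.dt = (1/4 : ℝ) • (u.dx.dx + (3:ℝ) • (u * u) + (3:ℝ) • (α * u.Dsd)).dx

/-- The Lax operator `L = ∂² + αD + u`. -/
def Lop {N : ℕ} (α u ψ : SF N) : SF N := ψ.dx.dx + α * ψ.Dsd + u * ψ

/-- The operator `M = (1/2)α∂D + λ∂ + (1/2)u∂ − (1/4)(∂α)D − (1/4)(∂u)`. -/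
def Mop {N : ℕ} (α u : SF N) (lam : ℝ) (ψ : SF N) : SF N :=
  (1/2 : ℝ) • (α * ψ.Dsd.dx) + lam • ψ.dx + (1/2 : ℝ) • (u * ψ.dx)
    - (1/4 : ℝ) • (α.dx * ψ.Dsd) - (1/4 : ℝ) • (u.dx * ψ)

/-- The linear system `Lψ = λψ`, `∂ₜψ = Mψ` associated with `(α,u)` at `λ`. -/
def LinSys {N : ℕ} (α u : SF N) (lam : ℝ) (ψ : SF N) : Prop :=
  Lop α u ψ = lam • ψ ∧ ψ.dt = Mop α u lam ψ

/-- `δ₀ = −(Dθ₀)θ₀⁻¹`. -/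
def delta0 {N : ℕ} (θ : SF N) : SF N := -(θ.Dsd * θ.sinv)

/-- The Darboux-transformed `α̂ = −α − 2∂δ₀`. -/
def hatAlpha {N : ℕ} (α θ : SF N) : SF N := -α - (2:ℝ) • (delta0 θ).dx

/-- The Darboux-transformed `û = u + Dα + 2δ₀(α + ∂δ₀)`. -/
def hatU {N : ℕ} (α u θ : SF N) : SF N :=
  u + α.Dsd + (2:ℝ) • (delta0 θ * (α + (delta0 θ).dx))

/-- `darbIter θ m j = θ_j[m]`, the `j`-th seed after `m` Darboux steps. -/
def darbIter {N : ℕ} (θ : ℕ → SF N) : ℕ → ℕ → SF N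
  | 0, j => θ j
  | m + 1, j => (darbIter θ m j).Dsd + delta0 (darbIter θ m m) * darbIter θ m j

/-- `Titer θ n ψ = T_n ψ = (D+δ_{n−1})⋯(D+δ₀)ψ`. -/
def Titer {N : ℕ} (θ : ℕ → SF N) : ℕ → SF N → SF N
  | 0, ψ => ψ
  | m + 1, ψ => (Titer θ m ψ).Dsd + delta0 (darbIter θ m m) * Titer θ m ψ

/-- Determinant of a matrix of superfields: Leibniz formula with rows in
ascending order (for matrices of commuting, e.g. even, entries this is the usual
determinant, and when exactly one row is odd it agrees with the Laplace
expansion along that row). -/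
def detSF {N k : ℕ} (M : Matrix (Fin k) (Fin k) (SF N)) : SF N :=
  ∑ σ : Equiv.Perm (Fin k),
    ((Equiv.Perm.sign σ : ℤ)) • (((List.finRange k).map fun i => M i (σ i)).prod)

/-- Entrywise `D`-derivative of a matrix of superfields. -/
def DmatSF {N m n : ℕ} (M : Matrix (Fin m) (Fin n) (SF N)) : Matrix (Fin m) (Fin n) (SF N) :=
  Matrix.of fun i j => (M i j).Dsd

/-- The embedding `Fin (k−1) → Fin k` skipping `j`. -/
def dropIdx {k : ℕ} (j : Fin k) (i : Fin (k - 1)) : Fin k :=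
  ⟨if i.1 < j.1 then i.1 else i.1 + 1, by
    have h1 := i.2; have h2 := j.2; split <;> omega⟩

/-- The minor of `M` obtained by deleting row `j` and column `i`. -/
def minorSF {N k : ℕ} (M : Matrix (Fin k) (Fin k) (SF N)) (j i : Fin k) :
    Matrix (Fin (k-1)) (Fin (k-1)) (SF N) :=
  M.submatrix (dropIdx j) (dropIdx i)

/-- Adjugate matrix (matrix of cofactors, transposed). -/
def adjSF {N k : ℕ} (M : Matrix (Fin k) (Fin k) (SF N)) : Matrix (Fin k) (Fin k) (SF N) :=
  Matrix.of fun i j => ((-1 : ℤ) ^ (i.1 + j.1)) • detSF (minorSF M j i)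

/-- Inverse of a matrix of (even) superfields, via the adjugate
(junk unless `detSF M` is invertible). -/
def invSF {N k : ℕ} (M : Matrix (Fin k) (Fin k) (SF N)) : Matrix (Fin k) (Fin k) (SF N) :=
  Matrix.of fun i j => (detSF M).sinv * adjSF M i j

section EvenWronskian

variable {N : ℕ}

/-- `θ^{(0)} = (θ₀, θ₂, …)`. -/
def evenSeq (θ : ℕ → SF N) : ℕ → SF N := fun j => θ (2 * j)

/-- `θ^{(1)} = (θ₁, θ₃, …)`. -/
def oddSeq (θ : ℕ → SF N) : ℕ → SF N := fun j => θ (2 * j + 1)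

/-- The `k×k` Wronski matrix with rows `v, ∂v, …, ∂^{k−1}v`. -/
def Wmat (N : ℕ) (k : ℕ) (v : ℕ → SF N) : Matrix (Fin k) (Fin k) (SF N) :=
  Matrix.of fun i j => Xpow i.1 (v j.1)

/-- The Wronski matrix with last row replaced by `∂^k v`. -/
def WmatHat (N : ℕ) (k : ℕ) (v : ℕ → SF N) : Matrix (Fin k) (Fin k) (SF N) :=
  Matrix.of fun i j => if i.1 = k - 1 then Xpow k (v j.1) else Xpow i.1 (v j.1)

/-- The Wronski matrix with rows `Dv, D∂v, …, D∂^{k−2}v` and last row `∂^k v`. -/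
def WmatBarD (N : ℕ) (k : ℕ) (v : ℕ → SF N) : Matrix (Fin k) (Fin k) (SF N) :=
  Matrix.of fun i j => if i.1 = k - 1 then Xpow k (v j.1) else (Xpow i.1 (v j.1)).Dsd

/-- `W^{(0)}` (even case, `n = 2k`). -/
def W0E (N k : ℕ) (θ : ℕ → SF N) : Matrix (Fin k) (Fin k) (SF N) := Wmat N k (evenSeq θ)

/-- `W^{(1)}` (even case, `n = 2k`). -/
def W1E (N k : ℕ) (θ : ℕ → SF N) : Matrix (Fin k) (Fin k) (SF N) := Wmat N k (oddSeq θ)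

/-- The Schur complement `W^{(0)} − W^{(1)}(DW^{(1)})⁻¹DW^{(0)}`. -/
def SchurE (N k : ℕ) (θ : ℕ → SF N) : Matrix (Fin k) (Fin k) (SF N) :=
  W0E N k θ - W1E N k θ * invSF (DmatSF (W1E N k θ)) * DmatSF (W0E N k θ)

/-- The Schur complement `DW^{(1)} − (DW^{(0)})(W^{(0)})⁻¹W^{(1)}`. -/
def SchurE2 (N k : ℕ) (θ : ℕ → SF N) : Matrix (Fin k) (Fin k) (SF N) :=
  DmatSF (W1E N k θ) - DmatSF (W0E N k θ) * invSF (W0E N k θ) * W1E N k θ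

/-- `sdet 𝒲` (even case). -/
def sdetE (N k : ℕ) (θ : ℕ → SF N) : SF N :=
  detSF (SchurE N k θ) * (detSF (DmatSF (W1E N k θ))).sinv

/-- The Schur complement of the block matrix `𝒲̂` (even case). -/
def SchurEHat (N k : ℕ) (θ : ℕ → SF N) : Matrix (Fin k) (Fin k) (SF N) :=
  WmatHat N k (evenSeq θ) - WmatHat N k (oddSeq θ) * invSF (DmatSF (W1E N k θ)) * DmatSF (W0E N k θ)

/-- `sdet 𝒲̂` (even case). -/
def sdetEHat (N k : ℕ) (θ : ℕ → SF N) : SF N :=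
  detSF (SchurEHat N k θ) * (detSF (DmatSF (W1E N k θ))).sinv

end EvenWronskian

section OddWronskian

/-- `W^{(0)}`, a `(k+1)×(k+1)` matrix (odd case, `n = 2k+1`). -/
def W0O (N k : ℕ) (θ : ℕ → SF N) : Matrix (Fin (k+1)) (Fin (k+1)) (SF N) :=
  Matrix.of fun i j => Xpow i.1 (θ (2 * j.1))

/-- `W^{(1)}`, a `(k+1)×k` matrix (odd case). -/
def W1O (N k : ℕ) (θ : ℕ → SF N) : Matrix (Fin (k+1)) (Fin k) (SF N) :=
  Matrix.of fun i j => Xpow i.1 (θ (2 * j.1 + 1))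

/-- `W̃^{(0)}`: `W^{(0)}` with its last row removed. -/
def Wtil0 (N k : ℕ) (θ : ℕ → SF N) : Matrix (Fin k) (Fin (k+1)) (SF N) :=
  Matrix.of fun i j => Xpow i.1 (θ (2 * j.1))

/-- `W̃^{(1)}`: `W^{(1)}` with its last row removed. -/
def Wtil1 (N k : ℕ) (θ : ℕ → SF N) : Matrix (Fin k) (Fin k) (SF N) :=
  Matrix.of fun i j => Xpow i.1 (θ (2 * j.1 + 1))

/-- `W̌^{(0)}`: `W^{(0)}` with its second-to-last row removed. -/
def Wchk0 (N k : ℕ) (θ : ℕ → SF N) : Matrix (Fin k) (Fin (k+1)) (SF N) :=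
  Matrix.of fun i j => Xpow (if i.1 = k - 1 then k else i.1) (θ (2 * j.1))

/-- `W̌^{(1)}`: `W^{(1)}` with its second-to-last row removed. -/
def Wchk1 (N k : ℕ) (θ : ℕ → SF N) : Matrix (Fin k) (Fin k) (SF N) :=
  Matrix.of fun i j => Xpow (if i.1 = k - 1 then k else i.1) (θ (2 * j.1 + 1))

/-- `Ŵ^{(0)}`: `W^{(0)}` with last row `∂^k θ^{(0)}` replaced by `D∂^k θ^{(0)}`. -/
def W0OHat (N k : ℕ) (θ : ℕ → SF N) : Matrix (Fin (k+1)) (Fin (k+1)) (SF N) :=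
  Matrix.of fun i j => if i.1 = k then Dpow (2*k+1) (θ (2 * j.1)) else Xpow i.1 (θ (2 * j.1))

/-- `Ŵ^{(1)}`: `W^{(1)}` with last row `∂^k θ^{(1)}` replaced by `D∂^k θ^{(1)}`. -/
def W1OHat (N k : ℕ) (θ : ℕ → SF N) : Matrix (Fin (k+1)) (Fin k) (SF N) :=
  Matrix.of fun i j => if i.1 = k then Dpow (2*k+1) (θ (2 * j.1 + 1)) else Xpow i.1 (θ (2 * j.1 + 1))

/-- The Schur complement `W^{(0)} − W^{(1)}(DW̃^{(1)})⁻¹DW̃^{(0)}`. -/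
def SchurO (N k : ℕ) (θ : ℕ → SF N) : Matrix (Fin (k+1)) (Fin (k+1)) (SF N) :=
  W0O N k θ - W1O N k θ * invSF (DmatSF (Wtil1 N k θ)) * DmatSF (Wtil0 N k θ)

/-- The Schur complement `W^{(0)} − W^{(1)}(DW̌^{(1)})⁻¹DW̌^{(0)}`. -/
def SchurOchk (N k : ℕ) (θ : ℕ → SF N) : Matrix (Fin (k+1)) (Fin (k+1)) (SF N) :=
  W0O N k θ - W1O N k θ * invSF (DmatSF (Wchk1 N k θ)) * DmatSF (Wchk0 N k θ)

/-- The Schur complement `Ŵ^{(0)} − Ŵ^{(1)}(DW̃^{(1)})⁻¹DW̃^{(0)}`. -/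
def SchurOHat (N k : ℕ) (θ : ℕ → SF N) : Matrix (Fin (k+1)) (Fin (k+1)) (SF N) :=
  W0OHat N k θ - W1OHat N k θ * invSF (DmatSF (Wtil1 N k θ)) * DmatSF (Wtil0 N k θ)

/-- `sdet 𝒲` (odd case). -/
def sdetO (N k : ℕ) (θ : ℕ → SF N) : SF N :=
  detSF (SchurO N k θ) * (detSF (DmatSF (Wtil1 N k θ))).sinv

/-- `sdet 𝒲̌` (odd case). -/
def sdetOchk (N k : ℕ) (θ : ℕ → SF N) : SF N :=
  detSF (SchurOchk N k θ) * (detSF (DmatSF (Wchk1 N k θ))).sinv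

/-- The quotient `det(Ŵ^{(0)} − Ŵ^{(1)}(DW̃^{(1)})⁻¹DW̃^{(0)}) / det(W^{(0)} − W^{(1)}(DW̃^{(1)})⁻¹DW̃^{(0)})`. -/
def Qodd (N k : ℕ) (θ : ℕ → SF N) : SF N :=
  detSF (SchurOHat N k θ) * (detSF (SchurO N k θ)).sinv

end OddWronskian

namespace SFAux
variable {N : ℕ}

/-- The basis of the exterior algebra. -/
def bas (N : ℕ) : Module.Basis (Finset (Fin N)) ℝ (SuperAlg N) :=
  (Pi.basisFun ℝ (Fin N)).ExteriorAlgebra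

/-- The grade involution. -/
abbrev sg : SuperAlg N →ₐ[ℝ] SuperAlg N :=
  CliffordAlgebra.involute (Q := (0 : QuadraticForm ℝ (Fin N → ℝ)))

lemma sg_sg (x : SuperAlg N) : sg (sg x) = x := CliffordAlgebra.involute_involute x

lemma eq_zero_of_eq_neg {x : SuperAlg N} (h : x = -x) : x = 0 := by
  have h2 : (2 : ℝ) • x = 0 := by rw [two_smul]; nth_rewrite 2 [h]; simp
  exact (smul_eq_zero.mp h2).resolve_left two_ne_zero

lemma decomp (x : SuperAlg N) : ∃ y ∈ LambdaEven N, ∃ z ∈ LambdaOdd N, y + z = x := by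
  have h := (CliffordAlgebra.evenOdd_isCompl (0 : QuadraticForm ℝ (Fin N → ℝ))).sup_eq_top
  have hx : x ∈ (⊤ : Submodule ℝ (SuperAlg N)) := trivial
  have h' : LambdaEven N ⊔ LambdaOdd N = ⊤ := h
  rw [← h'] at hx
  exact Submodule.mem_sup.mp hx

lemma sg_even {x : SuperAlg N} (h : x ∈ LambdaEven N) : sg x = x :=
  CliffordAlgebra.involute_eq_of_mem_even h

lemma sg_odd {x : SuperAlg N} (h : x ∈ LambdaOdd N) : sg x = -x :=
  CliffordAlgebra.involute_eq_of_mem_odd h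

lemma mem_even_iff {x : SuperAlg N} : x ∈ LambdaEven N ↔ sg x = x := by
  refine ⟨sg_even, fun h => ?_⟩
  obtain ⟨y, hy, z, hz, rfl⟩ := decomp x
  rw [map_add, sg_even hy, sg_odd hz, add_right_inj] at h
  rw [eq_zero_of_eq_neg h.symm, add_zero]; exact hy

lemma mem_odd_iff {x : SuperAlg N} : x ∈ LambdaOdd N ↔ sg x = -x := by
  refine ⟨sg_odd, fun h => ?_⟩
  obtain ⟨y, hy, z, hz, rfl⟩ := decomp x
  rw [map_add, sg_even hy, sg_odd hz, neg_add, add_left_inj] at h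
  rw [eq_zero_of_eq_neg h, zero_add]; exact hz

lemma eq_of_functionals {x y : SuperAlg N} (h : ∀ l : SuperAlg N →ₗ[ℝ] ℝ, l x = l y) : x = y :=
  (bas N).ext_elem fun i => h ((bas N).coord i)

/-- Weak derivative. -/
def HasD (g : ℝ → SuperAlg N) (d : SuperAlg N) (x : ℝ) : Prop :=
  ∀ l : SuperAlg N →ₗ[ℝ] ℝ, HasDerivAt (fun y => l (g y)) (l d) x

lemma HasD.unique {g : ℝ → SuperAlg N} {d e : SuperAlg N} {x : ℝ} (h : HasD g d x)
    (h' : HasD g e x) : d = e := eq_of_functionals fun l => (h l).unique (h' l)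

lemma HasD.derLam {g : ℝ → SuperAlg N} {d : SuperAlg N} {x : ℝ} (h : HasD g d x) :
    derLam g x = d := by
  have hex : ∃ d : SuperAlg N, ∀ l : SuperAlg N →ₗ[ℝ] ℝ,
      HasDerivAt (fun y => l (g y)) (l d) x := ⟨d, h⟩
  unfold _root_.derLam
  rw [dif_pos hex]
  exact HasD.unique hex.choose_spec h

lemma derLam_eq_zero {g : ℝ → SuperAlg N} {x : ℝ} (h : ¬ ∃ d, HasD g d x) :
    derLam g x = 0 := by
  unfold _root_.derLam
  exact dif_neg h

lemma HasD.map {g : ℝ → SuperAlg N} {d : SuperAlg N} {x : ℝ} (h : HasD g d x)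
    (φ : SuperAlg N →ₗ[ℝ] SuperAlg N) : HasD (fun y => φ (g y)) (φ d) x :=
  fun l => h (l.comp φ)

lemma derLam_sg (g : ℝ → SuperAlg N) (x : ℝ) :
    derLam (fun y => sg (g y)) x = sg (derLam g x) := by
  by_cases h : ∃ d, HasD g d x
  · obtain ⟨d, hd⟩ := h
    rw [hd.derLam]
    exact (hd.map sg.toLinearMap).derLam
  · rw [derLam_eq_zero h, map_zero, derLam_eq_zero]
    rintro ⟨d, hd⟩
    refine h ⟨sg d, ?_⟩
    have := hd.map sg.toLinearMap
    simpa [sg_sg] using this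

lemma HasD.add {f g : ℝ → SuperAlg N} {d e : SuperAlg N} {x : ℝ} (h : HasD f d x)
    (h' : HasD g e x) : HasD (fun y => f y + g y) (d + e) x := by
  intro l
  simpa using (h l).fun_add (h' l)

lemma HasD.const (c : SuperAlg N) (x : ℝ) : HasD (fun _ => c) 0 x := by
  intro l
  simpa using hasDerivAt_const x (l c)

lemma l_expand (l : SuperAlg N →ₗ[ℝ] ℝ) (u v : SuperAlg N) :
    l (u * v) = ∑ j, l (u * bas N j) * (bas N).coord j v := by
  conv_lhs => rw [← (bas N).sum_repr v, Finset.mul_sum, map_sum]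
  refine Finset.sum_congr rfl fun j _ => ?_
  simp [mul_comm]

lemma HasD.mul {f g : ℝ → SuperAlg N} {d e : SuperAlg N} {x : ℝ} (h : HasD f d x)
    (h' : HasD g e x) : HasD (fun y => f y * g y) (d * g x + f x * e) x := by
  intro l
  rw [funext fun y => l_expand l (f y) (g y), map_add, l_expand l d, l_expand l (f x) e]
  rw [← Finset.sum_add_distrib]
  refine HasDerivAt.fun_sum fun j _ => ?_
  exact (h (l.comp (LinearMap.mulRight ℝ (bas N j)))).mul (h' ((bas N).coord j))

lemma smoothLam_of_coord {g : ℝ → ℝ → SuperAlg N}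
    (h : ∀ i, ContDiff ℝ (⊤ : ℕ∞) (fun p : ℝ × ℝ => (bas N).coord i (g p.1 p.2))) :
    SmoothLam g := by
  intro l
  have : (fun p : ℝ × ℝ => l (g p.1 p.2)) =
      fun p : ℝ × ℝ => ∑ i, (bas N).coord i (g p.1 p.2) * l (bas N i) := by
    funext p
    conv_lhs => rw [← (bas N).sum_repr (g p.1 p.2), map_sum]
    simp
  rw [this]
  exact ContDiff.sum fun i _ => (h i).mul contDiff_const

lemma smoothLam_add {f g : ℝ → ℝ → SuperAlg N} (hf : SmoothLam f) (hg : SmoothLam g) :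
    SmoothLam (fun x t => f x t + g x t) := by
  intro l
  simpa using (hf l).add (hg l)

lemma smoothLam_neg {f : ℝ → ℝ → SuperAlg N} (hf : SmoothLam f) :
    SmoothLam (fun x t => - f x t) := by
  intro l
  simpa using (hf l).neg

lemma smoothLam_sg {f : ℝ → ℝ → SuperAlg N} (hf : SmoothLam f) :
    SmoothLam (fun x t => sg (f x t)) := fun l => hf (l.comp sg.toLinearMap)

lemma smoothLam_const (c : SuperAlg N) : SmoothLam (fun _ _ => c) := fun _ => contDiff_const

lemma smoothLam_mul {f g : ℝ → ℝ → SuperAlg N} (hf : SmoothLam f) (hg : SmoothLam g) :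
    SmoothLam (fun x t => f x t * g x t) := by
  intro l
  rw [funext fun p : ℝ × ℝ => l_expand l (f p.1 p.2) (g p.1 p.2)]
  exact ContDiff.sum fun j _ =>
    (hf (l.comp (LinearMap.mulRight ℝ (bas N j)))).mul (hg ((bas N).coord j))

lemma contDiff_det {ι : Type*} [Fintype ι] [DecidableEq ι] {M : ℝ × ℝ → Matrix ι ι ℝ}
    (h : ∀ i j, ContDiff ℝ (⊤ : ℕ∞) (fun p => M p i j)) :
    ContDiff ℝ (⊤ : ℕ∞) (fun p => (M p).det) := by
  simp only [Matrix.det_apply']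
  exact ContDiff.sum fun σ _ => contDiff_const.mul (contDiff_prod fun i _ => h _ _)

lemma contDiff_adj {ι : Type*} [Fintype ι] [DecidableEq ι] {M : ℝ × ℝ → Matrix ι ι ℝ}
    (h : ∀ i j, ContDiff ℝ (⊤ : ℕ∞) (fun p => M p i j)) (i j : ι) :
    ContDiff ℝ (⊤ : ℕ∞) (fun p => (M p).adjugate i j) := by
  simp only [Matrix.adjugate_apply]
  refine contDiff_det fun a b => ?_
  simp only [Matrix.updateRow_apply]
  split
  · exact contDiff_const
  · exact h _ _

lemma smoothLam_inverse {f : ℝ → ℝ → SuperAlg N} (hf : SmoothLam f)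
    (hu : ∀ x t, IsUnit (f x t)) : SmoothLam (fun x t => Ring.inverse (f x t)) := by
  classical
  refine smoothLam_of_coord fun i => ?_
  set M : ℝ × ℝ → Matrix (Finset (Fin N)) (Finset (Fin N)) ℝ :=
    fun p => Algebra.leftMulMatrix (bas N) (f p.1 p.2) with hM
  have hMs : ∀ i j, ContDiff ℝ (⊤ : ℕ∞) (fun p => M p i j) := by
    intro i j
    have := hf (((bas N).coord i).comp (LinearMap.mulRight ℝ (bas N j)))
    simpa [hM, Algebra.leftMulMatrix_eq_repr_mul] using this
  have hdet : ∀ p, (M p).det ≠ 0 := by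
    intro p
    have : IsUnit (M p) := (hu p.1 p.2).map (Algebra.leftMulMatrix (bas N))
    exact ((Matrix.isUnit_iff_isUnit_det _).mp this).ne_zero
  have key : (fun p : ℝ × ℝ => (bas N).coord i (Ring.inverse (f p.1 p.2))) =
      fun p => (M p).det⁻¹ * ∑ j, (M p).adjugate i j * (bas N).repr 1 j := by
    funext p
    have h1 : (M p).mulVec ((bas N).repr (Ring.inverse (f p.1 p.2))) = (bas N).repr 1 := by
      rw [hM, Algebra.leftMulMatrix_mulVec_repr, Ring.mul_inverse_cancel _ (hu _ _)]
    have h2 : ∑ j, (M p).adjugate i j * (bas N).repr 1 j =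
        ((M p).adjugate.mulVec ((bas N).repr 1)) i := rfl
    rw [h2, ← h1, Matrix.mulVec_mulVec, Matrix.adjugate_mul, Matrix.smul_mulVec, Matrix.one_mulVec]
    simp [hdet p]
  rw [key]
  exact ((contDiff_det hMs).inv hdet).mul
    (ContDiff.sum fun j _ => (contDiff_adj hMs i j).mul contDiff_const)

lemma hasD_of_smooth {g : ℝ → ℝ → SuperAlg N} (hg : SmoothLam g) (x t : ℝ) :
    ∃ d, HasD (fun y => g y t) d x ∧ ∀ i, (bas N).coord i d =
      fderiv ℝ (fun p : ℝ × ℝ => (bas N).coord i (g p.1 p.2)) (x, t) (1, 0) := by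
  have hder : ∀ i, HasDerivAt (fun y => (bas N).coord i (g y t))
      (fderiv ℝ (fun p : ℝ × ℝ => (bas N).coord i (g p.1 p.2)) (x, t) (1, 0)) x := by
    intro i
    have h1 : HasFDerivAt (fun p : ℝ × ℝ => (bas N).coord i (g p.1 p.2)) _ (x, t) :=
      ((hg ((bas N).coord i)).differentiable (by simp) (x, t)).hasFDerivAt
    have h2 : HasDerivAt (fun y : ℝ => (y, t)) ((1 : ℝ), (0 : ℝ)) x :=
      (hasDerivAt_id x).prodMk (hasDerivAt_const x t)
    exact h1.comp_hasDerivAt x h2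
  refine ⟨∑ i, (fderiv ℝ (fun p : ℝ × ℝ => (bas N).coord i (g p.1 p.2)) (x, t) (1, 0)) •
    bas N i, ?_, ?_⟩
  · intro l
    have : (fun y => l (g y t)) = fun y => ∑ i, (bas N).coord i (g y t) * l (bas N i) := by
      funext y
      conv_lhs => rw [← (bas N).sum_repr (g y t), map_sum]
      simp
    rw [this, map_sum]
    simp only [map_smul, smul_eq_mul]
    exact HasDerivAt.fun_sum fun i _ => (hder i).mul_const _
  · intro i
    rw [Module.Basis.coord_apply, Module.Basis.repr_sum_self]

lemma hasD_derLam {g : ℝ → ℝ → SuperAlg N} (hg : SmoothLam g) (x t : ℝ) :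
    HasD (fun y => g y t) (derLam (fun y => g y t) x) x := by
  obtain ⟨d, hd, -⟩ := hasD_of_smooth hg x t
  rw [hd.derLam]; exact hd

lemma smoothLam_der {g : ℝ → ℝ → SuperAlg N} (hg : SmoothLam g) :
    SmoothLam (fun x t => derLam (fun y => g y t) x) := by
  refine smoothLam_of_coord fun i => ?_
  have : (fun p : ℝ × ℝ => (bas N).coord i (derLam (fun y => g y p.2) p.1)) =
      fun p => fderiv ℝ (fun p : ℝ × ℝ => (bas N).coord i (g p.1 p.2)) p (1, 0) := by
    funext p
    obtain ⟨d, hd, hd'⟩ := hasD_of_smooth hg p.1 p.2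
    rw [hd.derLam, hd']
  rw [this]
  exact ((hg _).fderiv_right (m := ((⊤ : ℕ∞) : WithTop ℕ∞)) (by simp)).clm_apply contDiff_const

@[simp] lemma add_c0 (f g : SF N) (x t : ℝ) : (f + g).c0 x t = f.c0 x t + g.c0 x t := rfl
@[simp] lemma add_c1 (f g : SF N) (x t : ℝ) : (f + g).c1 x t = f.c1 x t + g.c1 x t := rfl
@[simp] lemma neg_c0 (f : SF N) (x t : ℝ) : (-f).c0 x t = -f.c0 x t := rfl
@[simp] lemma neg_c1 (f : SF N) (x t : ℝ) : (-f).c1 x t = -f.c1 x t := rfl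
@[simp] lemma zero_c0 (x t : ℝ) : (0 : SF N).c0 x t = 0 := rfl
@[simp] lemma zero_c1 (x t : ℝ) : (0 : SF N).c1 x t = 0 := rfl
@[simp] lemma one_c0 (x t : ℝ) : (1 : SF N).c0 x t = 1 := rfl
@[simp] lemma one_c1 (x t : ℝ) : (1 : SF N).c1 x t = 0 := rfl
@[simp] lemma mul_c0 (f g : SF N) (x t : ℝ) : (f * g).c0 x t = f.c0 x t * g.c0 x t := rfl
@[simp] lemma mul_c1 (f g : SF N) (x t : ℝ) :
    (f * g).c1 x t = f.c1 x t * g.c0 x t + sg (f.c0 x t) * g.c1 x t := rfl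
@[simp] lemma D_c0 (f : SF N) (x t : ℝ) : f.Dsd.c0 x t = f.c1 x t := rfl
@[simp] lemma D_c1 (f : SF N) (x t : ℝ) : f.Dsd.c1 x t = derLam (fun y => f.c0 y t) x := rfl

lemma sf_ext {f g : SF N} (h0 : ∀ x t, f.c0 x t = g.c0 x t) (h1 : ∀ x t, f.c1 x t = g.c1 x t) :
    f = g := SF.ext (funext fun x => funext fun t => h0 x t) (funext fun x => funext fun t => h1 x t)

lemma sf_mul_assoc (f g h : SF N) : f * g * h = f * (g * h) := by
  apply sf_ext <;> intro x t <;> simp [mul_assoc, mul_add, add_mul, add_assoc]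

lemma sf_mul_add (f g h : SF N) : f * (g + h) = f * g + f * h := by
  apply sf_ext <;> intro x t <;> simp [mul_add]; abel

lemma sf_add_mul (f g h : SF N) : (f + g) * h = f * h + g * h := by
  apply sf_ext <;> intro x t <;> simp [add_mul]; abel

lemma sf_neg_mul (f g : SF N) : (-f) * g = -(f * g) := by
  apply sf_ext <;> intro x t <;> simp; abel

lemma sf_mul_neg (f g : SF N) : f * (-g) = -(f * g) := by
  apply sf_ext <;> intro x t <;> simp; abel

lemma sf_one_mul (f : SF N) : 1 * f = f := by
  apply sf_ext <;> intro x t <;> simp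

lemma sf_mul_one (f : SF N) : f * 1 = f := by
  apply sf_ext <;> intro x t <;> simp

lemma sf_zero_mul (f : SF N) : 0 * f = 0 := by
  apply sf_ext <;> intro x t <;> simp

lemma sf_mul_zero (f : SF N) : f * 0 = 0 := by
  apply sf_ext <;> intro x t <;> simp

lemma sf_mul_sum (f : SF N) (s : Finset ℕ) (g : ℕ → SF N) :
    f * ∑ i ∈ s, g i = ∑ i ∈ s, f * g i := by
  induction s using Finset.cons_induction with
  | empty => simp [sf_mul_zero]
  | cons a s ha ih => rw [Finset.sum_cons, Finset.sum_cons, sf_mul_add, ih]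

lemma sg_inverse {u : SuperAlg N} (hu : IsUnit u) : Ring.inverse (sg u) = sg (Ring.inverse u) := by
  have h : sg u * sg (Ring.inverse u) = 1 := by
    rw [← map_mul, Ring.mul_inverse_cancel _ hu, map_one]
  have h' : Ring.inverse (sg u) * sg u = 1 := Ring.inverse_mul_cancel _ (hu.map sg)
  exact left_inv_eq_right_inv h' h

lemma sinv_mul {f : SF N} (hf : f.Invertible) : f.sinv * f = 1 := by
  apply sf_ext <;> intro x t
  · exact Ring.inverse_mul_cancel _ (hf x t)
  · change -(Ring.inverse (sg (f.c0 x t)) * f.c1 x t * Ring.inverse (f.c0 x t)) * f.c0 x t +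
      sg (Ring.inverse (f.c0 x t)) * f.c1 x t = 0
    rw [sg_inverse (hf x t), neg_mul, mul_assoc _ _ (f.c0 x t),
      Ring.inverse_mul_cancel _ (hf x t), mul_one, neg_add_cancel]

lemma mul_sinv {f : SF N} (hf : f.Invertible) : f * f.sinv = 1 := by
  apply sf_ext <;> intro x t
  · exact Ring.mul_inverse_cancel _ (hf x t)
  · change f.c1 x t * Ring.inverse (f.c0 x t) + sg (f.c0 x t) *
      -(Ring.inverse (sg (f.c0 x t)) * f.c1 x t * Ring.inverse (f.c0 x t)) = 0
    rw [mul_neg, ← mul_assoc, ← mul_assoc, Ring.mul_inverse_cancel _ ((hf x t).map sg), one_mul,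
      add_neg_cancel]

/-! Smoothness -/

lemma smooth_add {f g : SF N} (hf : f.Smooth) (hg : g.Smooth) : (f + g).Smooth :=
  ⟨smoothLam_add hf.1 hg.1, smoothLam_add hf.2 hg.2⟩

lemma smooth_neg {f : SF N} (hf : f.Smooth) : (-f).Smooth :=
  ⟨smoothLam_neg hf.1, smoothLam_neg hf.2⟩

lemma smooth_zero : (0 : SF N).Smooth := ⟨smoothLam_const 0, smoothLam_const 0⟩

lemma smooth_one : (1 : SF N).Smooth := ⟨smoothLam_const 1, smoothLam_const 0⟩

lemma smooth_mul {f g : SF N} (hf : f.Smooth) (hg : g.Smooth) : (f * g).Smooth :=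
  ⟨smoothLam_mul hf.1 hg.1,
    smoothLam_add (smoothLam_mul hf.2 hg.1) (smoothLam_mul (smoothLam_sg hf.1) hg.2)⟩

lemma smooth_D {f : SF N} (hf : f.Smooth) : f.Dsd.Smooth := ⟨hf.2, smoothLam_der hf.1⟩

lemma smooth_sinv {f : SF N} (hf : f.Smooth) (hi : f.Invertible) : f.sinv.Smooth :=
  ⟨smoothLam_inverse hf.1 hi, smoothLam_neg (smoothLam_mul (smoothLam_mul
    (smoothLam_inverse (smoothLam_sg hf.1) fun x t => (hi x t).map sg) hf.2)
    (smoothLam_inverse hf.1 hi))⟩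

lemma smooth_delta {f : SF N} (hf : f.Smooth) (hi : f.Invertible) : (delta0 f).Smooth :=
  smooth_neg (smooth_mul (smooth_D hf) (smooth_sinv hf hi))

lemma smooth_Dpow {f : SF N} (hf : f.Smooth) (m : ℕ) : (Dpow m f).Smooth := by
  induction m with
  | zero => exact hf
  | succ m ih => exact smooth_D ih

lemma smooth_sum (s : Finset ℕ) (g : ℕ → SF N) (h : ∀ i, (g i).Smooth) :
    (∑ i ∈ s, g i).Smooth := by
  induction s using Finset.cons_induction with
  | empty => exact smooth_zero
  | cons a s ha ih => rw [Finset.sum_cons]; exact smooth_add (h a) ih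

/-! The derivation -/

lemma D_add {f g : SF N} (hf : f.Smooth) (hg : g.Smooth) : (f + g).Dsd = f.Dsd + g.Dsd := by
  apply sf_ext <;> intro x t
  · rfl
  · exact ((hasD_derLam hf.1 x t).add (hasD_derLam hg.1 x t)).derLam

lemma D_zero : (0 : SF N).Dsd = 0 := by
  apply sf_ext <;> intro x t
  · rfl
  · exact (HasD.const 0 x).derLam

lemma D_one : (1 : SF N).Dsd = 0 := by
  apply sf_ext <;> intro x t
  · rfl
  · exact (HasD.const 1 x).derLam

lemma D_sum (s : Finset ℕ) (g : ℕ → SF N) (h : ∀ i, (g i).Smooth) :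
    (∑ i ∈ s, g i).Dsd = ∑ i ∈ s, (g i).Dsd := by
  induction s using Finset.cons_induction with
  | empty => exact D_zero
  | cons a s ha ih =>
    rw [Finset.sum_cons, Finset.sum_cons, D_add (h a) (smooth_sum s g h), ih]

/-- The parity automorphism of superfields. -/
def hat (f : SF N) : SF N := ⟨fun x t => sg (f.c0 x t), fun x t => -sg (f.c1 x t)⟩

@[simp] lemma hat_c0 (f : SF N) (x t : ℝ) : (hat f).c0 x t = sg (f.c0 x t) := rfl
@[simp] lemma hat_c1 (f : SF N) (x t : ℝ) : (hat f).c1 x t = -sg (f.c1 x t) := rfl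

lemma hat_add (f g : SF N) : hat (f + g) = hat f + hat g := by
  apply sf_ext <;> intro x t <;> simp; abel

lemma hat_neg (f : SF N) : hat (-f) = -hat f := by
  apply sf_ext <;> intro x t <;> simp

lemma hat_mul (f g : SF N) : hat (f * g) = hat f * hat g := by
  apply sf_ext <;> intro x t <;> simp; abel

lemma hat_one : hat (1 : SF N) = 1 := by
  apply sf_ext <;> intro x t <;> simp

lemma hat_zero : hat (0 : SF N) = 0 := by
  apply sf_ext <;> intro x t <;> simp

lemma hat_D (f : SF N) : hat f.Dsd = -(hat f).Dsd := by
  apply sf_ext <;> intro x t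
  · simp
  · simp [derLam_sg]

lemma smooth_hat {f : SF N} (hf : f.Smooth) : (hat f).Smooth :=
  ⟨smoothLam_sg hf.1, smoothLam_neg (smoothLam_sg hf.2)⟩

lemma D_neg (f : SF N) (hf : f.Smooth) : (-f).Dsd = -f.Dsd := by
  have h := D_add hf (smooth_neg hf)
  rw [add_neg_cancel, D_zero] at h
  exact (neg_eq_of_add_eq_zero_right h.symm).symm

lemma D_mul {f g : SF N} (hf : f.Smooth) (hg : g.Smooth) :
    (f * g).Dsd = f.Dsd * g + hat f * g.Dsd := by
  apply sf_ext <;> intro x t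
  · simp
  · have := ((hasD_derLam hf.1 x t).mul (hasD_derLam hg.1 x t)).derLam
    simp only [D_c1, D_c0, mul_c0, mul_c1, add_c1, hat_c0, hat_c1, sg_sg] at this ⊢
    rw [this, neg_mul]; abel

/-- Parity in terms of `hat`. -/
def Par (f : SF N) (m : ℕ) : Prop := (Even m → hat f = f) ∧ (¬ Even m → hat f = -f)

lemma par_iff (f : SF N) (m : ℕ) : parityAt f m ↔ Par f m := by
  have he : f.IsEven ↔ hat f = f := by
    constructor
    · rintro ⟨h0, h1⟩
      apply sf_ext <;> intro x t
      · exact sg_even (h0 x t)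
      · rw [hat_c1, sg_odd (h1 x t), neg_neg]
    · intro h
      refine ⟨fun x t => mem_even_iff.mpr ?_, fun x t => mem_odd_iff.mpr ?_⟩
      · rw [← hat_c0, h]
      · rw [← neg_neg (sg _), ← hat_c1, h]
  have ho : f.IsOdd ↔ hat f = -f := by
    constructor
    · rintro ⟨h0, h1⟩
      apply sf_ext <;> intro x t
      · exact sg_odd (h0 x t)
      · rw [hat_c1, sg_even (h1 x t)]; rfl
    · intro h
      refine ⟨fun x t => mem_odd_iff.mpr ?_, fun x t => mem_even_iff.mpr ?_⟩
      · rw [← hat_c0, h]; rfl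
      · rw [← neg_neg (sg _), ← hat_c1, h, neg_c1, neg_neg]
  unfold parityAt Par
  rw [he, ho, Nat.even_iff]
  split <;> simp_all

lemma par_add {f g : SF N} {m : ℕ} (hf : Par f m) (hg : Par g m) : Par (f + g) m :=
  ⟨fun h => by rw [hat_add, hf.1 h, hg.1 h], fun h => by rw [hat_add, hf.2 h, hg.2 h, neg_add]⟩

lemma par_neg {f : SF N} {m : ℕ} (hf : Par f m) : Par (-f) m :=
  ⟨fun h => by rw [hat_neg, hf.1 h], fun h => by rw [hat_neg, hf.2 h]⟩

lemma par_zero (m : ℕ) : Par (0 : SF N) m :=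
  ⟨fun _ => hat_zero, fun _ => by rw [hat_zero, neg_zero]⟩

lemma par_mul {f g : SF N} {m k : ℕ} (hf : Par f m) (hg : Par g k) : Par (f * g) (m + k) := by
  by_cases h1 : Even m <;> by_cases h2 : Even k <;> simp [Par, Nat.even_add, h1, h2, hat_mul]
  · rw [hf.1 h1, hg.1 h2]
  · rw [hf.1 h1, hg.2 h2, sf_mul_neg]
  · rw [hf.2 h1, hg.1 h2, sf_neg_mul]
  · rw [hf.2 h1, hg.2 h2, sf_neg_mul, sf_mul_neg, neg_neg]

lemma par_congr {f : SF N} {m k : ℕ} (hf : Par f m) (h : Even m ↔ Even k) : Par f k := by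
  unfold Par at *; rwa [← h]

lemma par_D {f : SF N} {m : ℕ} (hs : f.Smooth) (hf : Par f m) : Par f.Dsd (m + 1) := by
  by_cases h : Even m <;> simp [Par, Nat.even_add_one, h, hat_D]
  · rw [hf.1 h]
  · rw [hf.2 h, D_neg _ hs, neg_neg]

lemma par_hat {f : SF N} {m : ℕ} (hf : Par f m) : Par (hat f) m :=
  ⟨fun h => by rw [hf.1 h, hf.1 h], fun h => by rw [hf.2 h, hat_neg, hf.2 h]⟩

lemma par_sinv {f : SF N} {m : ℕ} (hm : Even m) (hi : f.Invertible) (hf : Par f m) :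
    Par f.sinv 0 := by
  refine ⟨fun _ => ?_, fun h => absurd (by simp) h⟩
  have h1 : hat f.sinv * f = 1 := by
    have h := hat_mul f.sinv f
    rw [sinv_mul hi, hat_one, hf.1 hm] at h
    exact h.symm
  calc hat f.sinv = hat f.sinv * (f * f.sinv) := by rw [mul_sinv hi, sf_mul_one]
    _ = f.sinv := by rw [← sf_mul_assoc, h1, sf_one_mul]

lemma par_delta {f : SF N} {m : ℕ} (hm : Even m) (hs : f.Smooth) (hi : f.Invertible)
    (hf : Par f m) : Par (delta0 f) 1 := by
  refine par_neg (par_congr (par_mul (par_D hs hf) (par_sinv hm hi hf)) ?_)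
  simp [Nat.even_add_one, hm]

/-! Darboux -/

lemma titer_eq (θ : ℕ → SF N) (m j : ℕ) : Titer θ m (θ j) = darbIter θ m j := by
  induction m with
  | zero => rfl
  | succ m ih => simp only [Titer, darbIter, ih]

lemma darb_kill {f : SF N} (hi : f.Invertible) : f.Dsd + delta0 f * f = 0 := by
  rw [delta0, sf_neg_mul, sf_mul_assoc, sinv_mul hi, sf_mul_one, add_neg_cancel]

lemma titer_kill (θ : ℕ → SF N) (j k : ℕ) (hi : (darbIter θ j j).Invertible) :
    Titer θ (j + 1 + k) (θ j) = 0 := by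
  induction k with
  | zero => rw [titer_eq]; exact darb_kill hi
  | succ k ih =>
    rw [← add_assoc, Titer, ih, D_zero, sf_mul_zero, add_zero]

lemma darb_props (n : ℕ) (θ : ℕ → SF N) (hθs : ∀ j < n, (θ j).Smooth)
    (hθp : ∀ j < n, Par (θ j) j) (hinv : ∀ m < n, (darbIter θ m m).Invertible) (m : ℕ)
    (hm : m ≤ n) : ∀ j < n, (darbIter θ m j).Smooth ∧ Par (darbIter θ m j) (m + j) := by
  induction m with
  | zero => intro j hj; exact ⟨hθs j hj, by rw [Nat.zero_add]; exact hθp j hj⟩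
  | succ m ih =>
    intro j hj
    have ih' := ih (by omega)
    obtain ⟨hs, hp⟩ := ih' j hj
    obtain ⟨hsm, hpm⟩ := ih' m (by omega)
    have hi := hinv m (by omega)
    refine ⟨smooth_add (smooth_D hs) (smooth_mul (smooth_delta hsm hi) hs), par_add ?_ ?_⟩
    · have := par_D hs hp
      rwa [show m + 1 + j = m + j + 1 by ring]
    · have := par_mul (par_delta (by simp) hsm hi hpm) hp
      rwa [show m + 1 + j = 1 + (m + j) by ring]

lemma titer_form (n : ℕ) (θ : ℕ → SF N) (hθs : ∀ j < n, (θ j).Smooth)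
    (hθp : ∀ j < n, Par (θ j) j) (hinv : ∀ m < n, (darbIter θ m m).Invertible) (m : ℕ)
    (hm : m ≤ n) : ∃ a : ℕ → SF N, (∀ i, (a i).Smooth) ∧ (∀ i, Par (a i) (m + i)) ∧
      a m = 1 ∧ (∀ i, m < i → a i = 0) ∧
      ∀ ψ : SF N, ψ.Smooth → Titer θ m ψ = ∑ i ∈ Finset.range (m + 1), a i * Dpow i ψ := by
  induction m with
  | zero =>
    refine ⟨fun i => if i = 0 then 1 else 0, fun i => ?_, fun i => ?_, by simp, fun i hi => ?_, ?_⟩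
    · dsimp only; split
      · exact smooth_one
      · exact smooth_zero
    · dsimp only; split
      · subst i; exact ⟨fun _ => hat_one, fun h => absurd (by simp) h⟩
      · exact par_zero _
    · simp; omega
    · intro ψ _
      simp [Titer, Dpow, sf_one_mul]
  | succ m ih =>
    obtain ⟨a, has, hap, ham, ha0, hT⟩ := ih (by omega)
    obtain ⟨hsm, hpm⟩ := darb_props n θ hθs hθp hinv m (by omega) m (by omega)
    have hi := hinv m (by omega)
    set δ := delta0 (darbIter θ m m) with hδ
    have hδs : δ.Smooth := smooth_delta hsm hi
    have hδp : Par δ 1 := par_delta (by simp) hsm hi hpm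
    set b : ℕ → SF N := fun i => (a i).Dsd + δ * a i with hb
    set c : ℕ → SF N := fun i => Nat.casesOn i 0 fun k => hat (a k) with hc
    have hbp : ∀ i, Par (b i) (m + 1 + i) := fun i => by
      have h1 := par_D (has i) (hap i)
      have h2 := par_mul hδp (hap i)
      rw [show m + i + 1 = m + 1 + i by ring] at h1
      rw [show 1 + (m + i) = m + 1 + i by ring] at h2
      exact par_add h1 h2
    refine ⟨fun i => b i + c i, fun i => smooth_add
      (smooth_add (smooth_D (has i)) (smooth_mul hδs (has i))) ?_,
      fun i => par_add (hbp i) ?_, ?_, ?_, ?_⟩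
    · cases i with
      | zero => exact smooth_zero
      | succ k => exact smooth_hat (has k)
    · cases i with
      | zero => exact par_zero _
      | succ k =>
        refine par_congr (par_hat (hap k)) ?_
        rw [show m + 1 + (k + 1) = (m + k) + 2 by ring]
        simp [Nat.even_add]
    · simp only [hb, hc]
      rw [ha0 (m + 1) (by omega), ham, hat_one, D_zero, sf_mul_zero, zero_add, zero_add]
    · intro i hi
      cases i with
      | zero => omega
      | succ k =>
        simp only [hb, hc]
        rw [ha0 (k + 1) (by omega), ha0 k (by omega), hat_zero, D_zero, sf_mul_zero, zero_add,
          zero_add]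
    · intro ψ hψ
      have hbm : b (m + 1) = 0 := by
        simp only [hb]
        rw [ha0 (m + 1) (by omega), D_zero, sf_mul_zero, zero_add]
      rw [Titer, hT ψ hψ, D_sum _ _ fun i => smooth_mul (has i) (smooth_Dpow hψ i), ← hδ,
        sf_mul_sum, Finset.sum_congr rfl fun i _ => D_mul (has i) (smooth_Dpow hψ i)]
      simp only [sf_add_mul, Finset.sum_add_distrib]
      have hc0 : c 0 = 0 := rfl
      rw [Finset.sum_range_succ (fun i => b i * Dpow i ψ) (m + 1), hbm, sf_zero_mul, add_zero,
        Finset.sum_range_succ' (fun i => c i * Dpow i ψ) (m + 1), hc0,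
        sf_zero_mul, add_zero]
      simp only [hb, hc, sf_add_mul, Finset.sum_add_distrib, sf_mul_assoc, Dpow]
      abel

end SFAux

/-- the iterated Darboux operator `T_n = (D+δ_{n−1})⋯(D+δ₀)`
annihilates all the seeds and has the form `D^n + Σ_{i<n} a_i D^i` with
`a_i` of parity `(−1)^{n−i}`. -/
theorem statement_4 {N : ℕ} (hN : 1 ≤ N) (n : ℕ) (hn : 1 ≤ n) (θ : ℕ → SF N)
    (hθs : ∀ j < n, (θ j).Smooth)
    (hθp : ∀ j < n, parityAt (θ j) j)
    (hinv : ∀ m < n, (darbIter θ m m).Invertible) :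
    (∀ j < n, Titer θ n (θ j) = 0) ∧
    ∃ a : Fin n → SF N,
      (∀ i : Fin n, parityAt (a i) (n + i.1)) ∧
      (∀ ψ : SF N, ψ.Smooth →
        Titer θ n ψ = Dpow n ψ + ∑ i : Fin n, a i * Dpow i.1 ψ) ∧
      (∀ j < n, Dpow n (θ j) + ∑ i : Fin n, a i * Dpow i.1 (θ j) = 0) := by
  have hp : ∀ j < n, SFAux.Par (θ j) j := fun j hj => (SFAux.par_iff _ _).mp (hθp j hj)
  have hA : ∀ j < n, Titer θ n (θ j) = 0 := by
    intro j hj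
    obtain ⟨k, rfl⟩ := Nat.exists_eq_add_of_le (show j + 1 ≤ n from hj)
    exact SFAux.titer_kill θ j k (hinv j hj)
  obtain ⟨a, -, hap, ham, -, hT⟩ := SFAux.titer_form n θ hθs hp hinv n le_rfl
  have hB : ∀ ψ : SF N, ψ.Smooth →
      Titer θ n ψ = Dpow n ψ + ∑ i : Fin n, a i.1 * Dpow i.1 ψ := by
    intro ψ hψ
    rw [hT ψ hψ, Finset.sum_range_succ, ham, SFAux.sf_one_mul, add_comm,
      Finset.sum_range (fun i => a i * Dpow i ψ)]
  refine ⟨hA, fun i => a i.1, fun i => (SFAux.par_iff _ _).mpr (hap i), hB, fun j hj => ?_⟩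
  rw [← hB _ (hθs j hj)]
  exact hA j hj
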